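/- Let m ≥ 2 be a natural number and let (A,+,·) be a left brace with A^{(3)} = {0} and A^{m+1} = {0}. Let a ∈ A and define a_1 = a, a_{j+1} = a*a_j for j ≥ 1. Then for every integer n (possibly negative) and every j with 1 ≤ j ≤ m, (n·a)*a_j = ∑_{k=1}^{m−j} C(n,k)·a_{k+j}, where C(n,k) = n(n−1)⋯(n−k+1)/k! is the generalized binomial coefficient and n·a is the additive integer multiple of a. -/

import Mathlib

/-- `λ_a(b) = -a + a·b` for a left-brace multiplication `mul`. -/
def braceLam {A : Type*} [AddCommGroup A] (mul : A → A → A) (a b : A) : A :=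
  -a + mul a b

/-- The star operation `a * b = λ_a(b) - b`. -/
def braceStar {A : Type*} [AddCommGroup A] (mul : A → A → A) (a b : A) : A :=
  braceLam mul a b - b

/-- `rightSeries mul r` is `A^{(r+1)}` of the paper: `rightSeries mul 0 = A^{(1)} = A` and
`rightSeries mul (r+1) = A^{(r+2)} = A^{(r+1)} * A`, the additive subgroup generated by
star products of elements of `A^{(r+1)}` with elements of `A`. -/
def rightSeries {A : Type*} [AddCommGroup A] (mul : A → A → A) : ℕ → AddSubgroup A
  | 0 => ⊤
  | r + 1 => AddSubgroup.closure {x | ∃ z c, z ∈ rightSeries mul r ∧ x = braceStar mul z c}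

/-- `leftSeries mul r` is `A^{r+1}` of the paper: `leftSeries mul 0 = A^1 = A` and
`leftSeries mul (r+1) = A^{r+2} = A * A^{r+1}`, the additive subgroup generated by
star products of elements of `A` with elements of `A^{r+1}`. -/
def leftSeries {A : Type*} [AddCommGroup A] (mul : A → A → A) : ℕ → AddSubgroup A
  | 0 => ⊤
  | r + 1 => AddSubgroup.closure {x | ∃ c z, z ∈ leftSeries mul r ∧ x = braceStar mul c z}

section LeftBrace

variable {A : Type*} [AddCommGroup A] {mul : A → A → A}

theorem mul_eq_add_braceLam (a b : A) : mul a b = a + braceLam mul a b := by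
  simp [braceLam]

theorem braceLam_eq_braceStar_add (a b : A) : braceLam mul a b = braceStar mul a b + b := by
  simp [braceStar]

theorem braceLam_add (hdist : ∀ a b c : A, mul a (b + c) = mul a b - a + mul a c) (a b c : A) :
    braceLam mul a (b + c) = braceLam mul a b + braceLam mul a c := by
  simp only [braceLam, hdist]
  abel

/-- The map `λ_a` as an endomorphism of the additive group. -/
def braceLamHom (hdist : ∀ a b c : A, mul a (b + c) = mul a b - a + mul a c) (a : A) : A →+ A :=
  AddMonoidHom.mk' (braceLam mul a) (braceLam_add hdist a)

theorem braceLam_zero_left (hzl : ∀ a : A, mul 0 a = a) (b : A) : braceLam mul 0 b = b := by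
  simp [braceLam, hzl]

theorem braceLam_mul (hassoc : ∀ a b c : A, mul (mul a b) c = mul a (mul b c))
    (hdist : ∀ a b c : A, mul a (b + c) = mul a b - a + mul a c) (a b c : A) :
    braceLam mul (mul a b) c = braceLam mul a (braceLam mul b c) := by
  have h : braceLam mul a (-b + mul b c) = -braceLam mul a b + braceLam mul a (mul b c) := by
    rw [braceLam_add hdist]
    exact congrArg (· + _) (map_neg (braceLamHom hdist a) b)
  rw [show braceLam mul b c = -b + mul b c from rfl, h]
  simp only [braceLam, hassoc]
  abel

theorem braceLam_injective (hassoc : ∀ a b c : A, mul (mul a b) c = mul a (mul b c))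
    (hzl : ∀ a : A, mul 0 a = a) (hinv : ∀ a : A, ∃ b : A, mul a b = 0 ∧ mul b a = 0)
    (hdist : ∀ a b c : A, mul a (b + c) = mul a b - a + mul a c) (a : A) :
    Function.Injective (braceLam mul a) := by
  obtain ⟨b, -, hb⟩ := hinv a
  refine Function.LeftInverse.injective (g := braceLam mul b) fun x => ?_
  rw [← braceLam_mul hassoc hdist, hb, braceLam_zero_left hzl]

theorem braceStar_mem_rightSeries_one (a b : A) : braceStar mul a b ∈ rightSeries mul 1 :=
  AddSubgroup.subset_closure ⟨a, b, AddSubgroup.mem_top a, rfl⟩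

theorem braceLam_of_mem_rightSeries_one (h3 : rightSeries mul 2 = ⊥) {z : A}
    (hz : z ∈ rightSeries mul 1) (c : A) : braceLam mul z c = c := by
  have h : braceStar mul z c ∈ rightSeries mul 2 := AddSubgroup.subset_closure ⟨z, c, hz, rfl⟩
  rw [h3, AddSubgroup.mem_bot] at h
  rw [braceLam_eq_braceStar_add, h, zero_add]

theorem braceLam_add_of_mem_rightSeries_one
    (hassoc : ∀ a b c : A, mul (mul a b) c = mul a (mul b c))
    (hzl : ∀ a : A, mul 0 a = a) (hinv : ∀ a : A, ∃ b : A, mul a b = 0 ∧ mul b a = 0)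
    (hdist : ∀ a b c : A, mul a (b + c) = mul a b - a + mul a c)
    (h3 : rightSeries mul 2 = ⊥) (x : A) {z : A} (hz : z ∈ rightSeries mul 1) (c : A) :
    braceLam mul (x + z) c = braceLam mul x c := by
  obtain ⟨y, hy, -⟩ := hinv x
  have hw : braceLam mul y z ∈ rightSeries mul 1 := by
    rw [braceLam_eq_braceStar_add]
    exact add_mem (braceStar_mem_rightSeries_one y z) hz
  have hxz : x + z = mul x (braceLam mul y z) := by
    rw [mul_eq_add_braceLam (mul := mul), ← braceLam_mul hassoc hdist, hy, braceLam_zero_left hzl]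
  rw [hxz, braceLam_mul hassoc hdist, braceLam_of_mem_rightSeries_one h3 hw]

/-- If `A^{(3)} = 0`, then `λ` is a homomorphism on the additive group. -/
theorem braceLam_add_left (hassoc : ∀ a b c : A, mul (mul a b) c = mul a (mul b c))
    (hzl : ∀ a : A, mul 0 a = a) (hinv : ∀ a : A, ∃ b : A, mul a b = 0 ∧ mul b a = 0)
    (hdist : ∀ a b c : A, mul a (b + c) = mul a b - a + mul a c)
    (h3 : rightSeries mul 2 = ⊥) (a b c : A) :
    braceLam mul (a + b) c = braceLam mul a (braceLam mul b c) := by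
  have hab : mul a b = a + b + braceStar mul a b := by
    rw [mul_eq_add_braceLam (mul := mul), braceLam_eq_braceStar_add]
    abel
  rw [← braceLam_mul hassoc hdist, hab, braceLam_add_of_mem_rightSeries_one hassoc hzl hinv hdist
    h3 _ (braceStar_mem_rightSeries_one a b)]

theorem leftSeries_succ_le (r : ℕ) : leftSeries mul (r + 1) ≤ leftSeries mul r := by
  induction r with
  | zero => exact le_top
  | succ r ih =>
    refine AddSubgroup.closure_mono ?_
    rintro x ⟨c, z, hz, rfl⟩
    exact ⟨c, z, ih hz, rfl⟩

theorem iterate_braceStar_mem_leftSeries {a : A} {f : ℕ → A}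
    (hf : ∀ j : ℕ, 1 ≤ j → f (j + 1) = braceStar mul a (f j)) (j : ℕ) :
    f (j + 1) ∈ leftSeries mul j := by
  induction j with
  | zero => exact AddSubgroup.mem_top _
  | succ j ih => exact AddSubgroup.subset_closure ⟨a, _, ih, hf _ (by omega)⟩

theorem iterate_braceStar_eq_zero {m : ℕ} (hL : leftSeries mul m = ⊥) {a : A} {f : ℕ → A}
    (hf : ∀ j : ℕ, 1 ≤ j → f (j + 1) = braceStar mul a (f j)) {j : ℕ} (hj : m < j) :
    f j = 0 := by
  obtain ⟨i, rfl⟩ : ∃ i, j = i + 1 := ⟨j - 1, by omega⟩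
  have h := antitone_nat_of_succ_le leftSeries_succ_le (show m ≤ i by omega)
    (iterate_braceStar_mem_leftSeries hf i)
  rwa [hL, AddSubgroup.mem_bot] at h

theorem braceLam_sum_choose (hdist : ∀ a b c : A, mul a (b + c) = mul a b - a + mul a c)
    {m : ℕ} (hL : leftSeries mul m = ⊥) {a : A} {f : ℕ → A}
    (hf : ∀ j : ℕ, 1 ≤ j → f (j + 1) = braceStar mul a (f j)) (n : ℤ) {j : ℕ} (hj : 1 ≤ j) :
    braceLam mul a (∑ k ∈ Finset.range (m + 1), Ring.choose n k • f (k + j)) =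
      ∑ k ∈ Finset.range (m + 1), Ring.choose (n + 1) k • f (k + j) := by
  have hlam (k : ℕ) : braceLamHom hdist a (f (k + j)) = f (k + 1 + j) + f (k + j) := by
    rw [show k + 1 + j = k + j + 1 by omega, hf _ (by omega)]
    exact braceLam_eq_braceStar_add _ _
  have hlast : f (m + 1 + j) = 0 := iterate_braceStar_eq_zero hL hf (by omega)
  change braceLamHom hdist a _ = _
  simp only [map_sum, map_zsmul, hlam, smul_add, Finset.sum_add_distrib]
  rw [Finset.sum_range_succ (fun k => Ring.choose n k • f (k + 1 + j)), hlast,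
    Finset.sum_range_succ' (fun k => Ring.choose n k • f (k + j)),
    Finset.sum_range_succ' (fun k => Ring.choose (n + 1) k • f (k + j))]
  simp only [Ring.choose_succ_succ, add_smul, Finset.sum_add_distrib, Ring.choose_zero_right,
    smul_zero, add_zero]
  abel

theorem braceLam_zsmul_eq_sum_choose
    (hassoc : ∀ a b c : A, mul (mul a b) c = mul a (mul b c))
    (hzl : ∀ a : A, mul 0 a = a) (hinv : ∀ a : A, ∃ b : A, mul a b = 0 ∧ mul b a = 0)
    (hdist : ∀ a b c : A, mul a (b + c) = mul a b - a + mul a c)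
    (h3 : rightSeries mul 2 = ⊥) {m : ℕ} (hL : leftSeries mul m = ⊥) {a : A} {f : ℕ → A}
    (hf : ∀ j : ℕ, 1 ≤ j → f (j + 1) = braceStar mul a (f j)) (n : ℤ) {j : ℕ} (hj : 1 ≤ j) :
    braceLam mul (n • a) (f j) =
      ∑ k ∈ Finset.range (m + 1), Ring.choose n k • f (k + j) := by
  have hstep (n : ℤ) : braceLam mul ((n + 1) • a) (f j) =
      braceLam mul a (braceLam mul (n • a) (f j)) := by
    rw [add_comm, add_smul, one_smul, braceLam_add_left hassoc hzl hinv hdist h3]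
  induction n using Int.induction_on with
  | zero =>
    rw [zero_smul, braceLam_zero_left hzl, Finset.sum_range_succ']
    simp
  | succ n ih => rw [hstep, ih, braceLam_sum_choose hdist hL hf _ hj]
  | pred n ih =>
    apply braceLam_injective hassoc hzl hinv hdist a
    rw [← hstep, braceLam_sum_choose hdist hL hf _ hj, sub_add_cancel, ih]

end LeftBrace

/-- Let `m ≥ 2`, `A` a left brace with `A^{(3)} = {0}` and `A^{m+1} = {0}`,
`a ∈ A`, `a_1 = a`, `a_{j+1} = a * a_j`.  Then for every integer `n` and `1 ≤ j ≤ m`,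
`(n·a) * a_j = ∑_{k=1}^{m-j} C(n,k)·a_{k+j}`, where `C(n,k) = Ring.choose n k` is the
generalized binomial coefficient. -/
theorem stmt13 {A : Type*} [AddCommGroup A] (m : ℕ) (hm : 2 ≤ m)
    (mul : A → A → A)
    (hassoc : ∀ a b c : A, mul (mul a b) c = mul a (mul b c))
    (hzl : ∀ a : A, mul 0 a = a)
    (hzr : ∀ a : A, mul a 0 = a)
    (hinv : ∀ a : A, ∃ b : A, mul a b = 0 ∧ mul b a = 0)
    (hdist : ∀ a b c : A, mul a (b + c) = mul a b - a + mul a c)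
    (h3 : rightSeries mul 2 = ⊥) (hL : leftSeries mul m = ⊥)
    (a : A) (f : ℕ → A) (hf1 : f 1 = a)
    (hf : ∀ j : ℕ, 1 ≤ j → f (j + 1) = braceStar mul a (f j)) :
    ∀ n : ℤ, ∀ j : ℕ, 1 ≤ j → j ≤ m →
      braceStar mul (n • a) (f j) =
        ∑ k ∈ Finset.Icc 1 (m - j), Ring.choose n k • f (k + j) := by
  intro n j hj hjm
  rw [braceStar, braceLam_zsmul_eq_sum_choose hassoc hzl hinv hdist h3 hL hf n hj,
    Finset.sum_range_succ', Ring.choose_zero_right, one_smul, zero_add, add_sub_cancel_right,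
    Finset.range_eq_Ico, Finset.sum_Ico_add' (fun k => Ring.choose n k • f (k + j)) 0 m 1]
  symm
  refine Finset.sum_subset (fun k hk => ?_) fun k hk hk' => ?_
  · simp only [Finset.mem_Icc, Finset.mem_Ico] at hk ⊢
    omega
  · simp only [Finset.mem_Icc, Finset.mem_Ico] at hk hk'
    rw [iterate_braceStar_eq_zero hL hf (show m < k + j by omega), smul_zero]
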